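/- For all i, j ∈ I: 𝒩(e_i(0), e_j(0)) = ⟨[P̄_j], [P̄_i]⟩ − ⟨[P̄_i], [P̄_j]⟩. -/

import Mathlib

namespace GQV

open Matrix

/-- Degree shift `η[d]`, i.e. `η[d]ᵢ(a) = ηᵢ(a + d)`. -/
noncomputable def shift {n : ℕ} (η : Fin n × ℝ → ℤ) (d : ℝ) : Fin n × ℝ → ℤ :=
  fun p => η (p.1, p.2 + d)

/-- The q-Cartan operator `C_q`. -/
noncomputable def Cq {n : ℕ} (b : Matrix (Fin n) (Fin n) ℤ) (η : Fin n × ℝ → ℤ) : Fin n × ℝ → ℤ :=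
  fun p =>
    η (p.1, p.2 + 1 / 2) + η (p.1, p.2 - 1 / 2)
      - ∑ i : Fin n, (if i < p.1 then b i p.1 * η (i, p.2 + 1 / 2) else 0)
      - ∑ j : Fin n, (if p.1 < j then b p.1 j * η (j, p.2 - 1 / 2) else 0)

/-- The pairing `η¹ · η² = Σ_{(i,a)} η¹ᵢ(a) η²ᵢ(a)`. -/
noncomputable def dotP {n : ℕ} (η₁ η₂ : Fin n × ℝ → ℤ) : ℤ := ∑ᶠ p, η₁ p * η₂ p

/-- The indicator function `e_{k,a}` of `(k,a)`. -/
noncomputable def eind {n : ℕ} (k : Fin n) (a : ℝ) : Fin n × ℝ → ℤ := fun p => if p = (k, a) then 1 else 0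

/-- Support contained in `I × ℤ`. -/
def SuppInt {n : ℕ} (η : Fin n × ℝ → ℤ) : Prop := ∀ p, η p ≠ 0 → ∃ m : ℤ, p.2 = (m : ℝ)

/-- Support contained in `I × (ℤ + 1/2)`. -/
def SuppHalfInt {n : ℕ} (η : Fin n × ℝ → ℤ) : Prop :=
  ∀ p, η p ≠ 0 → ∃ m : ℤ, p.2 = (m : ℝ) + 1 / 2

/-- The set `E`: functions supported on integer arguments, vanishing for all
sufficiently small arguments. -/
def memE {n : ℕ} (η : Fin n × ℝ → ℤ) : Prop :=
  SuppInt η ∧ ∃ N : ℤ, ∀ (k : Fin n) (a : ℝ), a < (N : ℝ) → η (k, a) = 0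

/-- The set `E[d] = {η[d] : η ∈ E}`. -/
def memEshift {n : ℕ} (d : ℝ) (η : Fin n × ℝ → ℤ) : Prop :=
  ∃ θ, memE θ ∧ η = shift θ d

/-- Functions on `I × (ℤ + 1/2)` vanishing for all sufficiently small arguments;
this is the set `E[1/2] = E[-1/2]`. -/
def memEhalf {n : ℕ} (η : Fin n × ℝ → ℤ) : Prop :=
  SuppHalfInt η ∧ ∃ N : ℤ, ∀ (k : Fin n) (a : ℝ), a < (N : ℝ) → η (k, a) = 0

/-- The strictly upper triangular part `b^>`. -/
def bUpper {n : ℕ} (b : Matrix (Fin n) (Fin n) ℤ) : Matrix (Fin n) (Fin n) ℤ :=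
  Matrix.of fun i j => if i < j then b i j else 0

/-- `E_Q = 1 - b^>`, the matrix of the Euler form. -/
def EQmat {n : ℕ} (b : Matrix (Fin n) (Fin n) ℤ) : Matrix (Fin n) (Fin n) ℤ := 1 - bUpper b

/-- The Euler form `⟨x, y⟩ = xᵀ E_Q y`. -/
def euler {n : ℕ} (b : Matrix (Fin n) (Fin n) ℤ) (x y : Fin n → ℤ) : ℤ :=
  x ⬝ᵥ (EQmat b *ᵥ y)

/-- The class `[Ī_i] = E_Q⁻¹ e_i` of the indecomposable injective with socle `S_i`. -/
noncomputable def Iinj {n : ℕ} (b : Matrix (Fin n) (Fin n) ℤ) (i : Fin n) : Fin n → ℤ :=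
  (EQmat b)⁻¹ *ᵥ Pi.single i 1

/-- The class `[P̄_i] = E_Q⁻ᵀ e_i` of the indecomposable projective with top `S_i`. -/
noncomputable def Pproj {n : ℕ} (b : Matrix (Fin n) (Fin n) ℤ) (i : Fin n) : Fin n → ℤ :=
  ((EQmat b)ᵀ)⁻¹ *ᵥ Pi.single i 1

/-- The Coxeter matrix `Φ = -E_Q⁻¹ E_Qᵀ`. -/
noncomputable def Cox {n : ℕ} (b : Matrix (Fin n) (Fin n) ℤ) : Matrix (Fin n) (Fin n) ℤ :=
  -((EQmat b)⁻¹ * (EQmat b)ᵀ)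

/-- The map `β`, defined `ℤ`-linearly by `β(e_{i,a}) = -Φ^a [Ī_i]` for `a ∈ ℤ`. -/
noncomputable def betaMap {n : ℕ} (b : Matrix (Fin n) (Fin n) ℤ) (η : Fin n × ℝ → ℤ) :
    Fin n → ℤ :=
  ∑ᶠ p : Fin n × ℤ, η (p.1, (p.2 : ℝ)) • ((-(Cox b ^ p.2)) *ᵥ Iinj b p.1)

/-- `𝒩(w¹,w²) = w¹[1/2]·C_q⁻¹w² − w¹[−1/2]·C_q⁻¹w² − w²[1/2]·C_q⁻¹w¹ + w²[−1/2]·C_q⁻¹w¹`,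
where `u₁ = C_q⁻¹ w¹`, `u₂ = C_q⁻¹ w²` are given as arguments. -/
noncomputable def Ncal {n : ℕ} (w₁ w₂ u₁ u₂ : Fin n × ℝ → ℤ) : ℤ :=
  dotP (shift w₁ (1 / 2)) u₂ - dotP (shift w₁ (-(1 / 2))) u₂
    - dotP (shift w₂ (1 / 2)) u₁ + dotP (shift w₂ (-(1 / 2))) u₁

/-- `ℰ'(w¹,w²) = −w¹[1/2]·C_q⁻¹w² + w²[1/2]·C_q⁻¹w¹`, where `u₁ = C_q⁻¹ w¹`,
`u₂ = C_q⁻¹ w²` are given as arguments. -/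
noncomputable def Ecal {n : ℕ} (w₁ w₂ u₁ u₂ : Fin n × ℝ → ℤ) : ℤ :=
  -dotP (shift w₁ (1 / 2)) u₂ + dotP (shift w₂ (1 / 2)) u₁

/-- The B-matrix of the level-1 ice quiver with z-pattern attached to `Q`. -/
def Btilde {n : ℕ} (b : Matrix (Fin n) (Fin n) ℤ) : Matrix (Fin n ⊕ Fin n) (Fin n) ℤ :=
  Matrix.of (Sum.elim (fun i k => b i k)
    (fun j k => -(if j = k then 1 else 0) + (if k < j then b k j else 0)))

/-- The index map: the `ℤ`-linear map on functions supported on `I × {-1, 0}`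
with `ind(e_{k,0}) = e_k` and `ind(e_{k,-1}) = e_{n+k} - e_k`. -/
noncomputable def indMap {n : ℕ} (w : Fin n × ℝ → ℤ) : Fin n ⊕ Fin n → ℤ :=
  Sum.elim (fun k => w (k, 0) - w (k, -1)) (fun k => w (k, -1))

end GQV


open Matrix GQV

theorem aux_vec {n : ℕ} (b : Matrix (Fin n) (Fin n) ℤ) (u : Fin n × ℝ → ℤ) (a : ℝ) :
    (fun k => GQV.Cq b u (k, a)) = (GQV.EQmat b)ᵀ *ᵥ (fun k => u (k, a + 1/2))
      + GQV.EQmat b *ᵥ (fun k => u (k, a - 1/2)) := by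
  funext k
  simp only [GQV.EQmat, Matrix.transpose_sub, Matrix.transpose_one, Matrix.sub_mulVec,
    Matrix.one_mulVec, Pi.add_apply, Pi.sub_apply, GQV.Cq]
  have h1 : ((GQV.bUpper b)ᵀ *ᵥ (fun k => u (k, a + 1/2))) k
      = ∑ i : Fin n, (if i < k then b i k * u (i, a + 1 / 2) else 0) := by
    simp [Matrix.mulVec, dotProduct, GQV.bUpper, ite_mul]
  have h2 : ((GQV.bUpper b) *ᵥ (fun k => u (k, a - 1/2))) k
      = ∑ j : Fin n, (if k < j then b k j * u (j, a - 1 / 2) else 0) := by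
    simp [Matrix.mulVec, dotProduct, GQV.bUpper, ite_mul]
  rw [h1, h2]; ring

theorem aux_det {n : ℕ} (b : Matrix (Fin n) (Fin n) ℤ) : (GQV.EQmat b).det = 1 := by
  rw [Matrix.det_of_upperTriangular]
  · simp [GQV.EQmat, GQV.bUpper]
  · intro i j hij
    have hij' : j < i := hij
    simp [GQV.EQmat, GQV.bUpper, hij'.ne', not_lt.2 hij'.le]

theorem aux_detT {n : ℕ} (b : Matrix (Fin n) (Fin n) ℤ) : IsUnit ((GQV.EQmat b)ᵀ).det := by
  rw [Matrix.det_transpose, aux_det]; exact isUnit_one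

theorem aux_solve {n : ℕ} (b : Matrix (Fin n) (Fin n) ℤ) (x y : Fin n → ℤ)
    (h : (GQV.EQmat b)ᵀ *ᵥ x = y) : x = ((GQV.EQmat b)ᵀ)⁻¹ *ᵥ y := by
  rw [← h, Matrix.mulVec_mulVec, Matrix.nonsing_inv_mul _ (aux_detT b), Matrix.one_mulVec]

theorem aux_neg {n : ℕ} (b : Matrix (Fin n) (Fin n) ℤ) (i : Fin n) (u : Fin n × ℝ → ℤ)
    (hu : GQV.memEhalf u) (h : GQV.Cq b u = GQV.eind i (0 : ℝ)) :
    (fun k => u (k, -(1/2))) = 0 := by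
  obtain ⟨-, N, hN⟩ := hu
  have key : ∀ m : ℕ, ∀ a : ℝ, a < 1/2 → a < N + m → (fun k => u (k, a)) = 0 := by
    intro m
    induction m with
    | zero => intro a _ h2; funext k; exact hN k a (by simpa using h2)
    | succ m ih =>
      intro a h1 h2
      push_cast at h2
      have hv := aux_vec b u (a - 1/2)
      rw [show a - 1/2 - 1/2 = a - 1 by ring, show a - 1/2 + 1/2 = a by ring,
        ih (a - 1) (by linarith) (by linarith), h] at hv
      have h0 : (fun k => GQV.eind i (0:ℝ) (k, a - 1/2)) = 0 := by
        funext k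
        have : a - 1/2 ≠ 0 := by linarith
        simp only [GQV.eind, Prod.mk.injEq, this, and_false, if_false, Pi.zero_apply]
      rw [h0, Matrix.mulVec_zero, add_zero] at hv
      simpa using aux_solve b _ _ hv.symm
  obtain ⟨m, hm⟩ := exists_nat_gt (-(1/2) - (N:ℝ))
  exact key m _ (by norm_num) (by linarith)

theorem aux_pos {n : ℕ} (b : Matrix (Fin n) (Fin n) ℤ) (i : Fin n) (u : Fin n × ℝ → ℤ)
    (hu : GQV.memEhalf u) (h : GQV.Cq b u = GQV.eind i (0 : ℝ)) :
    (fun k => u (k, 1/2)) = GQV.Pproj b i := by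
  have hv := aux_vec b u 0
  rw [zero_add, zero_sub, aux_neg b i u hu h, h, Matrix.mulVec_zero, add_zero] at hv
  have h0 : (fun k => GQV.eind i (0:ℝ) (k, 0)) = Pi.single i 1 := by
    funext k
    simp [GQV.eind, Pi.single_apply]
  rw [h0] at hv
  exact aux_solve b _ _ hv.symm

theorem aux_dot {n : ℕ} (i : Fin n) (u : Fin n × ℝ → ℤ) (d : ℝ) :
    GQV.dotP (GQV.shift (GQV.eind i (0:ℝ)) d) u = u (i, -d) := by
  unfold GQV.dotP
  rw [finsum_eq_single _ (i, -d)]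
  · simp [GQV.shift, GQV.eind]
  · rintro ⟨k, a⟩ hne
    have : ¬ (k = i ∧ a + d = 0) := by
      rintro ⟨rfl, h⟩
      exact hne (by rw [eq_neg_of_add_eq_zero_left h])
    simp [GQV.shift, GQV.eind, this]

theorem aux_euler {n : ℕ} (b : Matrix (Fin n) (Fin n) ℤ) (i : Fin n) (y : Fin n → ℤ) :
    GQV.euler b (GQV.Pproj b i) y = y i := by
  unfold GQV.euler GQV.Pproj
  rw [Matrix.dotProduct_mulVec, ← Matrix.mulVec_transpose, Matrix.mulVec_mulVec,
    Matrix.mul_nonsing_inv _ (aux_detT b), Matrix.one_mulVec, single_one_dotProduct]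

/-- `𝒩(e_i(0), e_j(0)) = ⟨[P̄_j], [P̄_i]⟩ − ⟨[P̄_i], [P̄_j]⟩`.
Here `u₁ = C_q⁻¹ e_i(0)` and `u₂ = C_q⁻¹ e_j(0)`. -/
theorem Ncal_zero_zero (n : ℕ) (hn : 0 < n) (b : Matrix (Fin n) (Fin n) ℤ)
    (hskew : bᵀ = -b) (hsign : ∀ i j : Fin n, i < j → 0 ≤ b i j)
    (i j : Fin n) (u₁ u₂ : Fin n × ℝ → ℤ)
    (hu₁ : GQV.memEhalf u₁) (hu₂ : GQV.memEhalf u₂)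
    (hu₁Cq : GQV.Cq b u₁ = GQV.eind i (0 : ℝ))
    (hu₂Cq : GQV.Cq b u₂ = GQV.eind j (0 : ℝ)) :
    GQV.Ncal (GQV.eind i (0 : ℝ)) (GQV.eind j (0 : ℝ)) u₁ u₂
      = GQV.euler b (GQV.Pproj b j) (GQV.Pproj b i)
        - GQV.euler b (GQV.Pproj b i) (GQV.Pproj b j) := by
  have p1 : ∀ k, u₁ (k, 1/2) = GQV.Pproj b i k := congrFun (aux_pos b i u₁ hu₁ hu₁Cq)
  have p2 : ∀ k, u₂ (k, 1/2) = GQV.Pproj b j k := congrFun (aux_pos b j u₂ hu₂ hu₂Cq)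
  have n1 : ∀ k, u₁ (k, -(1/2)) = 0 := congrFun (aux_neg b i u₁ hu₁ hu₁Cq)
  have n2 : ∀ k, u₂ (k, -(1/2)) = 0 := congrFun (aux_neg b j u₂ hu₂ hu₂Cq)
  unfold GQV.Ncal
  rw [aux_dot, aux_dot, aux_dot, aux_dot, neg_neg, n1, n2, p1, p2, aux_euler, aux_euler]
  ring
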